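/- Let X be a compact subset of ℝ^N equipped with a σ-finite Borel measure m, and let P be a Markov operator on L¹(X,m) satisfying ‖P f‖₁ = ‖f‖₁ for all f ∈ L¹(X,m). Let 𝒜 be an admissible family consisting of relatively open subsets of X such that ⋂_{A∈𝒜}(X \ A) = {φ̄} for a single point φ̄ ∈ X. Suppose there exists a measurable function u : X → [0,∞] with u > 0 a.e. that is locally integrable with respect to 𝒜 and properly subinvariant (there is a sequence (fₖ) of nonnegative L¹ functions increasing a.e. to u with lim P fₖ < u a.e.). Then for every density ρ₀ ∈ L¹(X,m) (ρ₀ ≥ 0 a.e., ∫ρ₀ dm = 1), the probability measures μ_n defined by μ_n(V) = ∫_V (Pⁿρ₀) dm converge weakly to the Dirac measure at φ̄; that is, ∫ g dμ_n → g(φ̄) for every continuous function g : X → ℝ. -/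

import Mathlib

open MeasureTheory Filter Topology ENNReal

/-- A Markov operator on `L¹(X,m)`, represented by a linear operator on (representatives of)
functions: it maps integrable functions to integrable functions, is positive
(`f ≥ 0` a.e. implies `P f ≥ 0` a.e.) and is an `L¹`-contraction. -/
def IsMarkovOperator {X : Type*} [MeasurableSpace X] (m : Measure X)
    (P : (X → ℝ) →ₗ[ℝ] (X → ℝ)) : Prop :=
  (∀ f : X → ℝ, Integrable f m → Integrable (P f) m) ∧
  (∀ f : X → ℝ, Integrable f m → 0 ≤ᵐ[m] f → 0 ≤ᵐ[m] P f) ∧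
  (∀ f : X → ℝ, Integrable f m → ∫ x, |P f x| ∂m ≤ ∫ x, |f x| ∂m)

/-- An admissible family `𝒜` of measurable sets: each member is measurable of finite
measure, `𝒜` is closed under pairwise unions, and a countable subfamily covers `X`
up to an `m`-null set. -/
def AdmissibleFamily {X : Type*} [MeasurableSpace X] (m : Measure X)
    (𝒜 : Set (Set X)) : Prop :=
  (∀ A ∈ 𝒜, MeasurableSet A ∧ m A < ⊤) ∧
  (∀ A ∈ 𝒜, ∀ B ∈ 𝒜, A ∪ B ∈ 𝒜) ∧
  (∃ g : ℕ → Set X, (∀ n, g n ∈ 𝒜) ∧ m (⋃ n, g n)ᶜ = 0)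

/-- `u : X → [0,∞]` is properly subinvariant for `P`: there is a sequence `(fₖ)` of
nonnegative `L¹` functions increasing pointwise a.e. to `u` such that the a.e. pointwise
limit `Pu` of `P fₖ` (the extension of `P` to `u`) satisfies `Pu < u` a.e. -/
def ProperlySubinvariant {X : Type*} [MeasurableSpace X] (m : Measure X)
    (P : (X → ℝ) →ₗ[ℝ] (X → ℝ)) (u : X → ℝ≥0∞) : Prop :=
  ∃ f : ℕ → X → ℝ,
    (∀ k, Integrable (f k) m) ∧ (∀ k, 0 ≤ᵐ[m] f k) ∧
    (∀ᵐ x ∂m, Monotone fun k => f k x) ∧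
    (∀ᵐ x ∂m, Filter.Tendsto (fun k => ENNReal.ofReal (f k x)) atTop (𝓝 (u x))) ∧
    ∃ Pu : X → ℝ≥0∞,
      (∀ᵐ x ∂m, Filter.Tendsto (fun k => ENNReal.ofReal (P (f k) x)) atTop (𝓝 (Pu x))) ∧
      (∀ᵐ x ∂m, Pu x < u x)

namespace IsMarkovOperator

variable {X : Type*} [MeasurableSpace X] {m : Measure X} {P : (X → ℝ) →ₗ[ℝ] (X → ℝ)}

lemma mono (hP : IsMarkovOperator m P) {f g : X → ℝ} (hf : Integrable f m)
    (hg : Integrable g m) (hfg : f ≤ᵐ[m] g) : P f ≤ᵐ[m] P g := by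
  have h := hP.2.1 (g - f) (hg.sub hf) (by
    filter_upwards [hfg] with x hx using sub_nonneg.2 hx)
  rw [map_sub] at h
  filter_upwards [h] with x hx using sub_nonneg.1 hx

lemma pow (hP : IsMarkovOperator m P) (n : ℕ) : IsMarkovOperator m (P ^ n) := by
  induction n with
  | zero => exact ⟨fun f hf => hf, fun f _ hf => hf, fun f _ => le_rfl⟩
  | succ n ih =>
    simp only [IsMarkovOperator, pow_succ', Module.End.mul_apply]
    exact ⟨fun f hf => hP.1 _ (ih.1 f hf), fun f hf h0 => hP.2.1 _ (ih.1 f hf) (ih.2.1 f hf h0),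
      fun f hf => (hP.2.2 _ (ih.1 f hf)).trans (ih.2.2 f hf)⟩

lemma integral_abs_sub_le (hP : IsMarkovOperator m P) {f g : X → ℝ} (hf : Integrable f m)
    (hg : Integrable g m) : ∫ x, |P f x - P g x| ∂m ≤ ∫ x, |f x - g x| ∂m := by
  simpa [map_sub] using hP.2.2 (f - g) (hf.sub hg)

/-- An integrable minorant of the increasing limit `v` of `f k` is mapped below the limit of
`P (f k)`. -/
lemma le_of_le_limit (hP : IsMarkovOperator m P) {f : ℕ → X → ℝ} {v pv H : X → ℝ}
    (hf : ∀ k, Integrable (f k) m) (hf0 : ∀ k, 0 ≤ᵐ[m] f k)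
    (hmono : ∀ᵐ x ∂m, Monotone fun k => f k x)
    (hv : ∀ᵐ x ∂m, Tendsto (fun k => f k x) atTop (𝓝 (v x)))
    (hpv : ∀ᵐ x ∂m, Tendsto (fun k => P (f k) x) atTop (𝓝 (pv x)))
    (hH : Integrable H m) (hHv : H ≤ᵐ[m] v) : P H ≤ᵐ[m] pv := by
  have hpvm : AEMeasurable pv m :=
    aemeasurable_of_tendsto_metrizable_ae atTop (fun k => (hP.1 _ (hf k)).aemeasurable) hpv
  have hmin : ∀ k, Integrable (fun x => min (H x) (f k x)) m := fun k => hH.inf (hf k)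
  have hPmono : ∀ᵐ x ∂m, Monotone fun k => P (f k) x := by
    have : ∀ᵐ x ∂m, ∀ k, P (f k) x ≤ P (f (k + 1)) x := ae_all_iff.2 fun k =>
      hP.mono (hf k) (hf (k + 1)) (by filter_upwards [hmono] with x hx using hx k.le_succ)
    filter_upwards [this] with x hx using monotone_nat_of_le_succ hx
  have hle : ∀ k, ∀ᵐ x ∂m, P (fun x => min (H x) (f k x)) x ≤ pv x := by
    intro k
    filter_upwards [hP.mono (hmin k) (hf k) (ae_of_all _ fun x => min_le_right _ _), hPmono, hpv]
      with x h1 h2 h3 using h1.trans (h2.ge_of_tendsto h3 k)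
  have hlim : Tendsto (fun k => ∫ x, |H x - min (H x) (f k x)| ∂m) atTop (𝓝 0) := by
    have := tendsto_integral_of_dominated_convergence (μ := m)
      (F := fun k x => |H x - min (H x) (f k x)|) (f := fun _ => 0) (fun x => |H x|)
      (fun k => (hH.sub (hmin k)).abs.aestronglyMeasurable) hH.abs
      (fun k => by
        filter_upwards [hf0 k] with x hx
        simp only [Pi.zero_apply] at hx
        rw [Real.norm_eq_abs, abs_abs]
        rcases le_total (H x) (f k x) with h | h
        · simp [h]
        · rw [min_eq_right h, abs_of_nonneg (sub_nonneg.2 h), abs_of_nonneg (hx.trans h)]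
          linarith)
      (by
        filter_upwards [hv, hHv] with x h1 h2
        have := ((tendsto_const_nhds (x := H x)).sub
          ((tendsto_const_nhds (x := H x)).min h1)).abs
        simpa [min_eq_left h2] using this)
    simpa using this
  have hzero : ∫⁻ x, ENNReal.ofReal (P H x - pv x) ∂m = 0 := by
    have hbound : ∀ k, ∫⁻ x, ENNReal.ofReal (P H x - pv x) ∂m ≤
        ENNReal.ofReal (∫ x, |H x - min (H x) (f k x)| ∂m) := by
      intro k
      calc ∫⁻ x, ENNReal.ofReal (P H x - pv x) ∂m
          ≤ ∫⁻ x, ENNReal.ofReal |P H x - P (fun x => min (H x) (f k x)) x| ∂m := by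
            apply lintegral_mono_ae
            filter_upwards [hle k] with x hx
            exact ENNReal.ofReal_le_ofReal ((sub_le_sub_left hx _).trans (le_abs_self _))
        _ = ENNReal.ofReal (∫ x, |P H x - P (fun x => min (H x) (f k x)) x| ∂m) :=
            (ofReal_integral_eq_lintegral_ofReal ((hP.1 _ hH).sub (hP.1 _ (hmin k))).abs
              (ae_of_all _ fun x => abs_nonneg _)).symm
        _ ≤ _ := ENNReal.ofReal_le_ofReal (hP.integral_abs_sub_le hH (hmin k))
    have h0 := ENNReal.tendsto_ofReal hlim
    rw [ENNReal.ofReal_zero] at h0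
    exact le_antisymm (ge_of_tendsto' h0 hbound) zero_le
  have hm : AEMeasurable (fun x => ENNReal.ofReal (P H x - pv x)) m :=
    ((hP.1 _ hH).aemeasurable.sub hpvm).ennreal_ofReal
  filter_upwards [(lintegral_eq_zero_iff' hm).1 hzero] with x hx
  simpa using hx

/-- Cauchy–Schwarz inequality for the extension of a linear operator, where `v` is a possibly
non-integrable function with image `pv`. -/
lemma sq_apply_le_mul {v pv h F : X → ℝ}
    (hle : ∀ H : X → ℝ, Integrable H m → H ≤ᵐ[m] v → P H ≤ᵐ[m] pv)
    (hv0 : ∀ᵐ x ∂m, 0 < v x) (hh : Integrable h m) (hF : Integrable F m)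
    (hhF : ∀ᵐ x ∂m, h x ^ 2 ≤ F x * v x) : ∀ᵐ x ∂m, P h x ^ 2 ≤ P F x * pv x := by
  have hq : ∀ᵐ x ∂m, ∀ s : ℚ, 2 * (s : ℝ) * P h x - (s : ℝ) ^ 2 * P F x ≤ pv x := by
    refine ae_all_iff.2 fun s => ?_
    have := hle ((2 * (s : ℝ)) • h - ((s : ℝ) ^ 2) • F) ((hh.smul _).sub (hF.smul _)) (by
      filter_upwards [hv0, hhF] with x h1 h2
      simp only [Pi.sub_apply, Pi.smul_apply, smul_eq_mul]
      by_contra! h3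
      nlinarith [sq_nonneg (v x - s * h x), mul_pos h1 (sub_pos.2 h3),
        mul_le_mul_of_nonneg_left h2 (sq_nonneg (s : ℝ))])
    rw [map_sub, map_smul, map_smul] at this
    filter_upwards [this] with x hx
    simpa using hx
  filter_upwards [hq] with x hx
  have hr : ∀ s : ℝ, 2 * s * P h x - s ^ 2 * P F x ≤ pv x := fun s =>
    Rat.denseRange_cast.induction_on (p := fun s : ℝ => 2 * s * P h x - s ^ 2 * P F x ≤ pv x) s
      (isClosed_le (by fun_prop) continuous_const) hx
  have := discrim_le_zero (a := P F x) (b := -2 * P h x) (c := pv x) (fun s => by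
    linarith [hr s])
  rw [discrim] at this
  linarith

/-- The weighted energy `∫ h² / v` decreases by at least `∫ w (P h)² / v` with `w = 1 - pv / v`. -/
lemma energy_step (hP : IsMarkovOperator m P) {v pv h : X → ℝ} (hvm : Measurable v)
    (hle : ∀ H : X → ℝ, Integrable H m → H ≤ᵐ[m] v → P H ≤ᵐ[m] pv)
    (hv0 : ∀ᵐ x ∂m, 0 < v x) (hpv0 : ∀ᵐ x ∂m, 0 ≤ pv x) (hlt : ∀ᵐ x ∂m, pv x < v x)
    (hh : Integrable h m) (hF : Integrable (fun x => h x ^ 2 / v x) m) :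
    Integrable (fun x => P h x ^ 2 / v x) m ∧
      ∫ x, (1 - pv x / v x) * (P h x ^ 2 / v x) ∂m ≤
        ∫ x, h x ^ 2 / v x ∂m - ∫ x, P h x ^ 2 / v x ∂m := by
  set F : X → ℝ := fun x => h x ^ 2 / v x with hFdef
  have hF0 : 0 ≤ᵐ[m] F := by
    filter_upwards [hv0] with x hx
    exact div_nonneg (sq_nonneg _) hx.le
  have hPF0 := hP.2.1 F hF hF0
  have hPFi := hP.1 F hF
  have hPhi := hP.1 h hh
  have hCS := sq_apply_le_mul hle hv0 hh hF (by
    filter_upwards [hv0] with x hx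
    rw [hFdef, div_mul_cancel₀ _ hx.ne'])
  have hpt : ∀ᵐ x ∂m, 0 ≤ P h x ^ 2 / v x ∧ 0 ≤ 1 - pv x / v x ∧ 1 - pv x / v x ≤ 1 ∧
      P h x ^ 2 / v x ≤ P F x * (pv x / v x) ∧ 0 ≤ P F x := by
    filter_upwards [hv0, hpv0, hlt, hPF0, hCS] with x h1 h2 h3 h4 h5
    refine ⟨div_nonneg (sq_nonneg _) h1.le, sub_nonneg.2 ((div_le_one h1).2 h3.le),
      by linarith [div_nonneg h2 h1.le], ?_, h4⟩
    rw [← mul_div_assoc]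
    exact div_le_div_of_nonneg_right h5 h1.le
  have hint : Integrable (fun x => P h x ^ 2 / v x) m := by
    refine hPFi.mono' ((hPhi.aemeasurable.pow_const 2).div hvm.aemeasurable).aestronglyMeasurable ?_
    filter_upwards [hpt] with x ⟨h1, h2, h3, h4, h5⟩
    rw [Real.norm_of_nonneg h1]
    nlinarith
  refine ⟨hint, ?_⟩
  have hPFle : ∫ x, P F x ∂m ≤ ∫ x, F x ∂m := by
    have := hP.2.2 F hF
    rwa [integral_congr_ae (g := P F), integral_congr_ae (f := fun x => |F x|) (g := F)] at this
    · filter_upwards [hF0] with x hx using abs_of_nonneg hx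
    · filter_upwards [hPF0] with x hx using abs_of_nonneg hx
  calc ∫ x, (1 - pv x / v x) * (P h x ^ 2 / v x) ∂m
      ≤ ∫ x, (P F x - P h x ^ 2 / v x) ∂m := by
        refine integral_mono_of_nonneg ?_ (hPFi.sub hint) ?_
        · filter_upwards [hpt] with x ⟨h1, h2, _⟩ using mul_nonneg h2 h1
        · filter_upwards [hpt] with x ⟨h1, h2, h3, h4, h5⟩
          nlinarith [mul_nonneg h2 h5, mul_nonneg h2 (sub_nonneg.2 h3)]
    _ = ∫ x, P F x ∂m - ∫ x, P h x ^ 2 / v x ∂m := integral_sub hPFi hint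
    _ ≤ _ := by linarith

/-- Sweeping for initial functions of finite weighted energy. -/
lemma tendsto_setIntegral_of_energy (hP : IsMarkovOperator m P) {v pv h : X → ℝ}
    (hvm : Measurable v) (hpvm : AEMeasurable pv m)
    (hle : ∀ H : X → ℝ, Integrable H m → H ≤ᵐ[m] v → P H ≤ᵐ[m] pv)
    (hv0 : ∀ᵐ x ∂m, 0 < v x) (hpv0 : ∀ᵐ x ∂m, 0 ≤ pv x) (hlt : ∀ᵐ x ∂m, pv x < v x)
    (hh : Integrable h m) (hh0 : 0 ≤ᵐ[m] h) (hF : Integrable (fun x => h x ^ 2 / v x) m)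
    {A : Set X} (hA : IntegrableOn v A m) :
    Tendsto (fun n : ℕ => ∫ x in A, (P ^ n) h x ∂m) atTop (𝓝 0) := by
  have hi : ∀ n, Integrable ((P ^ n) h) m := fun n => (hP.pow n).1 h hh
  have hnn : ∀ n, 0 ≤ᵐ[m] (P ^ n) h := fun n => (hP.pow n).2.1 h hh hh0
  have hFi : ∀ n, Integrable (fun x => (P ^ n) h x ^ 2 / v x) m := by
    intro n
    induction n with
    | zero => exact hF
    | succ n ih =>
      simp only [pow_succ' P n, Module.End.mul_apply]
      exact (hP.energy_step hvm hle hv0 hpv0 hlt (hi n) ih).1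
  set E : ℕ → ℝ := fun n => ∫ x, (P ^ n) h x ^ 2 / v x ∂m with hE
  set w : X → ℝ := fun x => 1 - pv x / v x with hw
  set G : ℕ → ℝ := fun n => ∫ x, w x * ((P ^ n) h x ^ 2 / v x) ∂m with hG
  have hw01 : ∀ᵐ x ∂m, 0 < w x ∧ w x ≤ 1 := by
    filter_upwards [hv0, hpv0, hlt] with x h1 h2 h3
    exact ⟨sub_pos.2 ((div_lt_one h1).2 h3), sub_le_self _ (div_nonneg h2 h1.le)⟩
  have hwm : AEMeasurable w m := (hpvm.div hvm.aemeasurable).const_sub 1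
  have hF0 : ∀ n, ∀ᵐ x ∂m, 0 ≤ (P ^ n) h x ^ 2 / v x := fun n => by
    filter_upwards [hv0] with x hx using div_nonneg (sq_nonneg _) hx.le
  have hwFi : ∀ n, Integrable (fun x => w x * ((P ^ n) h x ^ 2 / v x)) m := fun n => by
    refine (hFi n).mono' (hwm.mul (hFi n).aemeasurable).aestronglyMeasurable ?_
    filter_upwards [hw01, hF0 n] with x ⟨h1, h2⟩ h3
    rw [Real.norm_of_nonneg (mul_nonneg h1.le h3)]
    exact mul_le_of_le_one_left h3 h2
  have hG0 : ∀ n, 0 ≤ G n := fun n => integral_nonneg_of_ae (by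
    filter_upwards [hw01, hF0 n] with x h1 h3 using mul_nonneg h1.1.le h3)
  have hE0 : ∀ n, 0 ≤ E n := fun n => integral_nonneg_of_ae (hF0 n)
  have hstep : ∀ n, G (n + 1) ≤ E n - E (n + 1) := fun n => by
    simp only [hG, hE, pow_succ' P n, Module.End.mul_apply]
    exact (hP.energy_step hvm hle hv0 hpv0 hlt (hi n) (hFi n)).2
  have hanti : Antitone E := antitone_nat_of_succ_le fun n => by
    linarith [hstep n, hG0 (n + 1)]
  have hElim := tendsto_atTop_ciInf hanti ⟨0, by rintro _ ⟨n, rfl⟩; exact hE0 n⟩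
  have hGlim : Tendsto G atTop (𝓝 0) := by
    rw [← tendsto_add_atTop_iff_nat 1]
    refine squeeze_zero (fun n => hG0 _) hstep ?_
    simpa using hElim.sub ((tendsto_add_atTop_iff_nat 1).2 hElim)
  have hwA := ae_restrict_of_ae (s := A) hw01
  have hvA := ae_restrict_of_ae (s := A) hv0
  have hquoti : ∀ δ : ℝ, 0 < δ → ∀ K : ℕ, IntegrableOn (fun x => v x / (δ + K * w x)) A m := by
    intro δ hδ K
    refine (hA.div_const δ).mono'
      (hvm.aemeasurable.div ((hwm.restrict.const_mul _).const_add _)).aestronglyMeasurable ?_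
    filter_upwards [hwA, hvA] with x hx hvx
    have hK : 0 ≤ (K : ℝ) * w x := mul_nonneg K.cast_nonneg hx.1.le
    rw [Real.norm_of_nonneg (div_nonneg hvx.le (by linarith))]
    exact div_le_div_of_nonneg_left hvx.le hδ (by linarith)
  have hquot : ∀ δ : ℝ, 0 < δ →
      Tendsto (fun K : ℕ => ∫ x in A, v x / (δ + K * w x) ∂m) atTop (𝓝 0) := by
    intro δ hδ
    have := tendsto_integral_of_dominated_convergence (μ := m.restrict A)
      (F := fun (K : ℕ) x => v x / (δ + K * w x)) (f := fun _ => 0) (fun x => v x / δ)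
      (fun K => (hquoti δ hδ K).aestronglyMeasurable) (hA.div_const δ)
      (fun K => by
        filter_upwards [hwA, hvA] with x hx hvx
        have hK : 0 ≤ (K : ℝ) * w x := mul_nonneg K.cast_nonneg hx.1.le
        rw [Real.norm_of_nonneg (div_nonneg hvx.le (by linarith))]
        exact div_le_div_of_nonneg_left hvx.le hδ (by linarith))
      (by
        filter_upwards [hwA] with x hx
        exact Tendsto.const_div_atTop (tendsto_atTop_add_const_left _ _
          (tendsto_natCast_atTop_atTop.atTop_mul_const hx.1)) _)
    simpa using this
  have hbound : ∀ δ : ℝ, 0 < δ → ∀ K n : ℕ, ∫ x in A, (P ^ n) h x ∂m ≤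
      δ * E 0 + K * G n + ∫ x in A, v x / (δ + K * w x) ∂m := by
    intro δ hδ K n
    have hs : Integrable (fun x => δ * ((P ^ n) h x ^ 2 / v x) +
        K * (w x * ((P ^ n) h x ^ 2 / v x))) m :=
      ((hFi n).const_mul δ).add ((hwFi n).const_mul K)
    have hs0 : 0 ≤ᵐ[m] fun x => δ * ((P ^ n) h x ^ 2 / v x) +
        K * (w x * ((P ^ n) h x ^ 2 / v x)) := by
      filter_upwards [hw01, hF0 n] with x h1 h2
      exact add_nonneg (mul_nonneg hδ.le h2)
        (mul_nonneg K.cast_nonneg (mul_nonneg h1.1.le h2))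
    calc ∫ x in A, (P ^ n) h x ∂m
        ≤ ∫ x in A, ((δ * ((P ^ n) h x ^ 2 / v x) + K * (w x * ((P ^ n) h x ^ 2 / v x))) +
            v x / (δ + K * w x)) ∂m := by
          refine integral_mono_ae (hi n).integrableOn (hs.integrableOn.add (hquoti δ hδ K)) ?_
          filter_upwards [hwA, hvA] with x hx hvx
          have hc : 0 < δ + K * w x :=
            add_pos_of_pos_of_nonneg hδ (mul_nonneg K.cast_nonneg hx.1.le)
          generalize (P ^ n) h x = y
          have h1 : δ * (y ^ 2 / v x) + K * (w x * (y ^ 2 / v x)) + v x / (δ + K * w x) - y =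
              (((δ + K * w x) * y - v x / 2) ^ 2 + 3 / 4 * v x ^ 2) /
                (v x * (δ + K * w x)) := by
            field_simp
            ring
          have h2 : 0 ≤ (((δ + K * w x) * y - v x / 2) ^ 2 + 3 / 4 * v x ^ 2) /
                (v x * (δ + K * w x)) := by positivity
          linarith
      _ = ∫ x in A, (δ * ((P ^ n) h x ^ 2 / v x) + K * (w x * ((P ^ n) h x ^ 2 / v x))) ∂m +
            ∫ x in A, v x / (δ + K * w x) ∂m :=
          integral_add hs.integrableOn (hquoti δ hδ K)
      _ ≤ ∫ x, (δ * ((P ^ n) h x ^ 2 / v x) + K * (w x * ((P ^ n) h x ^ 2 / v x))) ∂m +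
            ∫ x in A, v x / (δ + K * w x) ∂m := by
          gcongr ?_ + _
          exact setIntegral_le_integral hs hs0
      _ = δ * E n + K * G n + ∫ x in A, v x / (δ + K * w x) ∂m := by
          rw [integral_add ((hFi n).const_mul δ) ((hwFi n).const_mul K), integral_const_mul,
            integral_const_mul]
      _ ≤ _ := by
          gcongr
          exact hanti n.zero_le
  rw [Metric.tendsto_atTop]
  intro ε hε
  set δ : ℝ := ε / (4 * (E 0 + 1)) with hδdef
  have hE1 : 0 < E 0 + 1 := by linarith [hE0 0]
  have hδ : 0 < δ := by positivity
  have hδE : δ * E 0 ≤ ε / 4 := by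
    have : δ * (E 0 + 1) = ε / 4 := by rw [hδdef]; field_simp
    linarith
  obtain ⟨K, hK⟩ := ((hquot δ hδ).eventually_lt_const (show (0 : ℝ) < ε / 4 by linarith)).exists
  have hKG : Tendsto (fun n => (K : ℝ) * G n) atTop (𝓝 0) := by
    simpa using hGlim.const_mul (K : ℝ)
  obtain ⟨n₀, hn₀⟩ := eventually_atTop.1 (hKG.eventually_lt_const (show (0 : ℝ) < ε / 4 by linarith))
  refine ⟨n₀, fun n hn => ?_⟩
  have h0 : 0 ≤ ∫ x in A, (P ^ n) h x ∂m :=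
    integral_nonneg_of_ae (ae_restrict_of_ae (hnn n))
  rw [Real.dist_eq, sub_zero, abs_of_nonneg h0]
  linarith [hbound δ hδ K n, hn₀ n hn]

/-- Sweeping from sets on which the strictly subinvariant function `v` is integrable. -/
lemma tendsto_setIntegral (hP : IsMarkovOperator m P) {v pv ρ : X → ℝ}
    (hvm : Measurable v) (hpvm : AEMeasurable pv m)
    (hle : ∀ H : X → ℝ, Integrable H m → H ≤ᵐ[m] v → P H ≤ᵐ[m] pv)
    (hv0 : ∀ᵐ x ∂m, 0 < v x) (hpv0 : ∀ᵐ x ∂m, 0 ≤ pv x) (hlt : ∀ᵐ x ∂m, pv x < v x)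
    (hρ : Integrable ρ m) (hρ0 : 0 ≤ᵐ[m] ρ) {A : Set X} (hA : IntegrableOn v A m) :
    Tendsto (fun n : ℕ => ∫ x in A, (P ^ n) ρ x ∂m) atTop (𝓝 0) := by
  set h : ℕ → X → ℝ := fun k x => min (ρ x) (k * v x) with hh
  have hmeas : ∀ k, AEMeasurable (h k) m := fun k =>
    hρ.aemeasurable.min (hvm.aemeasurable.const_mul _)
  have hpt : ∀ k, ∀ᵐ x ∂m, 0 ≤ h k x ∧ h k x ≤ ρ x ∧ h k x ≤ k * v x := fun k => by
    filter_upwards [hρ0, hv0] with x h1 h2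
    exact ⟨le_min h1 (by positivity), min_le_left _ _, min_le_right _ _⟩
  have hint : ∀ k, Integrable (h k) m := fun k => by
    refine hρ.mono' (hmeas k).aestronglyMeasurable ?_
    filter_upwards [hpt k] with x hx
    rw [Real.norm_of_nonneg hx.1]
    exact hx.2.1
  have hen : ∀ k, Integrable (fun x => h k x ^ 2 / v x) m := fun k => by
    refine (hρ.const_mul (k : ℝ)).mono'
      (((hmeas k).pow_const 2).div hvm.aemeasurable).aestronglyMeasurable ?_
    filter_upwards [hpt k, hv0] with x ⟨h1, h2, h3⟩ hv
    rw [Real.norm_of_nonneg (by positivity), div_le_iff₀ hv]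
    nlinarith [mul_le_mul h2 h3 h1 (h1.trans h2)]
  have hlim : Tendsto (fun k => ∫ x, |ρ x - h k x| ∂m) atTop (𝓝 0) := by
    have := tendsto_integral_of_dominated_convergence (μ := m)
      (F := fun k x => |ρ x - h k x|) (f := fun _ => 0) ρ
      (fun k => (hρ.sub (hint k)).abs.aestronglyMeasurable) hρ
      (fun k => by
        filter_upwards [hpt k] with x ⟨h1, h2, h3⟩
        rw [Real.norm_eq_abs, abs_abs, abs_of_nonneg (sub_nonneg.2 h2)]
        linarith)
      (by
        filter_upwards [hv0] with x hx
        refine tendsto_const_nhds.congr' ?_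
        filter_upwards [(tendsto_natCast_atTop_atTop.atTop_mul_const hx).eventually_ge_atTop (ρ x)]
          with k hk
        simp [hh, hk])
    simpa using this
  rw [Metric.tendsto_atTop]
  intro ε hε
  obtain ⟨k, hk⟩ := (hlim.eventually_lt_const (half_pos hε)).exists
  obtain ⟨n₀, hn₀⟩ := eventually_atTop.1 ((hP.tendsto_setIntegral_of_energy hvm hpvm hle hv0 hpv0 hlt
    (hint k) (by filter_upwards [hpt k] with x hx using hx.1) (hen k) hA).eventually_lt_const
    (half_pos hε))
  refine ⟨n₀, fun n hn => ?_⟩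
  have hi : ∀ {f : X → ℝ}, Integrable f m → Integrable ((P ^ n) f) m := fun hf => (hP.pow n).1 _ hf
  have h0 : 0 ≤ ∫ x in A, (P ^ n) ρ x ∂m :=
    integral_nonneg_of_ae (ae_restrict_of_ae ((hP.pow n).2.1 ρ hρ hρ0))
  rw [Real.dist_eq, sub_zero, abs_of_nonneg h0]
  have hd : Integrable (fun x => |(P ^ n) ρ x - (P ^ n) (h k) x|) m :=
    ((hi hρ).sub (hi (hint k))).abs
  have h1 : ∫ x in A, (P ^ n) ρ x ∂m ≤
      ∫ x in A, |(P ^ n) ρ x - (P ^ n) (h k) x| ∂m + ∫ x in A, (P ^ n) (h k) x ∂m := by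
    rw [← integral_add hd.integrableOn (hi (hint k)).integrableOn]
    refine integral_mono (hi hρ).integrableOn
      (hd.integrableOn.add (hi (hint k)).integrableOn) fun x => ?_
    linarith [le_abs_self ((P ^ n) ρ x - (P ^ n) (h k) x)]
  have h2 : ∫ x in A, |(P ^ n) ρ x - (P ^ n) (h k) x| ∂m ≤ ∫ x, |ρ x - h k x| ∂m :=
    (setIntegral_le_integral hd (ae_of_all _ fun x => abs_nonneg _)).trans
      ((hP.pow n).integral_abs_sub_le hρ (hint k))
  linarith [hn₀ n hn]

/-- A Markov operator with a positive, properly subinvariant, locally integrable function is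
sweeping with respect to the admissible family. -/
lemma sweeping (hP : IsMarkovOperator m P) {𝒜 : Set (Set X)} (h𝒜 : AdmissibleFamily m 𝒜)
    {u : X → ℝ≥0∞} (hu : Measurable u) (huPos : ∀ᵐ x ∂m, 0 < u x)
    (huLoc : ∀ A ∈ 𝒜, ∫⁻ x in A, u x ∂m < ⊤) (hsub : ProperlySubinvariant m P u)
    {ρ : X → ℝ} (hρ : Integrable ρ m) (hρ0 : 0 ≤ᵐ[m] ρ) {A : Set X} (hA : A ∈ 𝒜) :
    Tendsto (fun n : ℕ => ∫ x in A, (P ^ n) ρ x ∂m) atTop (𝓝 0) := by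
  obtain ⟨f, hfi, hf0, hmono, hfu, Pu, hPu, hlt⟩ := hsub
  have hutop : ∀ᵐ x ∂m, u x < ⊤ := by
    obtain ⟨g, hg, hcov⟩ := h𝒜.2.2
    have h1 : ∀ᵐ x ∂m, ∀ n, x ∈ g n → u x < ⊤ := ae_all_iff.2 fun n =>
      (ae_restrict_iff' (h𝒜.1 _ (hg n)).1).1 (ae_lt_top hu (huLoc _ (hg n)).ne)
    have h2 : ∀ᵐ x ∂m, x ∈ ⋃ n, g n := hcov
    filter_upwards [h1, h2] with x hx1 hx2
    obtain ⟨n, hn⟩ := Set.mem_iUnion.1 hx2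
    exact hx1 n hn
  have hv : ∀ᵐ x ∂m, Tendsto (fun k => f k x) atTop (𝓝 (u x).toReal) := by
    filter_upwards [hfu, hutop, ae_all_iff.2 hf0] with x h1 h2 h3
    refine ((ENNReal.tendsto_toReal h2.ne).comp h1).congr fun k => ?_
    exact ENNReal.toReal_ofReal (h3 k)
  have hpv : ∀ᵐ x ∂m, Tendsto (fun k => P (f k) x) atTop (𝓝 (Pu x).toReal) := by
    filter_upwards [hPu, hlt, ae_all_iff.2 fun k => hP.2.1 _ (hfi k) (hf0 k)] with x h1 h2 h3
    refine ((ENNReal.tendsto_toReal h2.ne_top).comp h1).congr fun k => ?_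
    exact ENNReal.toReal_ofReal (h3 k)
  refine hP.tendsto_setIntegral (v := fun x => (u x).toReal) (pv := fun x => (Pu x).toReal)
    hu.ennreal_toReal
    (aemeasurable_of_tendsto_metrizable_ae atTop (fun k => (hP.1 _ (hfi k)).aemeasurable) hpv)
    (fun H hH hHv => hP.le_of_le_limit hfi hf0 hmono hv hpv hH hHv) ?_
    (ae_of_all _ fun x => ENNReal.toReal_nonneg) ?_ hρ hρ0
    (integrable_toReal_of_lintegral_ne_top hu.aemeasurable (huLoc A hA).ne)
  · filter_upwards [huPos, hutop] with x h1 h2 using ENNReal.toReal_pos h1.ne' h2.ne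
  · filter_upwards [hlt, hutop] with x h1 h2 using ENNReal.toReal_strict_mono h2.ne h1

end IsMarkovOperator

/-- In a compact space, densities that lose all their mass on an upward directed family of open
sets exhausting the complement of a point concentrate at that point. -/
lemma tendsto_integral_mul_of_concentrating {X : Type*} [TopologicalSpace X] [CompactSpace X]
    [MeasurableSpace X] [BorelSpace X] {m : Measure X} {𝒜 : Set (Set X)}
    (hne : 𝒜.Nonempty) (hunion : ∀ A ∈ 𝒜, ∀ B ∈ 𝒜, A ∪ B ∈ 𝒜) (hopen : ∀ A ∈ 𝒜, IsOpen A)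
    {a : X} (hcover : ∀ x, x ≠ a → ∃ A ∈ 𝒜, x ∈ A) {ρ : ℕ → X → ℝ}
    (hρ : ∀ n, Integrable (ρ n) m) (hρ0 : ∀ n, 0 ≤ᵐ[m] ρ n) (hρ1 : ∀ n, ∫ x, ρ n x ∂m = 1)
    (hsweep : ∀ A ∈ 𝒜, Tendsto (fun n => ∫ x in A, ρ n x ∂m) atTop (𝓝 0))
    {g : X → ℝ} (hg : Continuous g) :
    Tendsto (fun n => ∫ x, g x * ρ n x ∂m) atTop (𝓝 (g a)) := by
  rw [Metric.tendsto_atTop]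
  intro ε hε
  obtain ⟨C, hC⟩ := isCompact_univ.exists_bound_of_continuousOn
    (hg.sub continuous_const : Continuous fun x => g x - g a).continuousOn
  replace hC : ∀ x, |g x - g a| ≤ C := fun x => hC x (Set.mem_univ x)
  have hC0 : 0 ≤ C := (abs_nonneg _).trans (hC a)
  have hKc : IsCompact {x | ε / 2 ≤ |g x - g a|} :=
    (isClosed_le continuous_const (hg.sub continuous_const).abs).isCompact
  obtain ⟨A, hA, hKA⟩ : ∃ A ∈ 𝒜, {x | ε / 2 ≤ |g x - g a|} ⊆ A := by
    have : Nonempty 𝒜 := hne.to_subtype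
    obtain ⟨A, hA⟩ := hKc.elim_directed_cover (fun A : 𝒜 => (A : Set X))
      (fun A => hopen A A.2) (fun x hx => by
        obtain ⟨A, hA, hxA⟩ := hcover x (by
          rintro rfl
          simp only [Set.mem_ofPred_eq, sub_self, abs_zero] at hx
          linarith)
        exact Set.mem_iUnion.2 ⟨⟨A, hA⟩, hxA⟩)
      (fun A B => ⟨⟨A ∪ B, hunion A A.2 B B.2⟩, Set.subset_union_left, Set.subset_union_right⟩)
    exact ⟨A, A.2, hA⟩
  have hlim : Tendsto (fun n => C * ∫ x in A, ρ n x ∂m) atTop (𝓝 0) := by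
    simpa using (hsweep A hA).const_mul C
  obtain ⟨n₀, hn₀⟩ := eventually_atTop.1 (hlim.eventually_lt_const (half_pos hε))
  refine ⟨n₀, fun n hn => ?_⟩
  have hAm := (hopen A hA).measurableSet
  have hgi : Integrable (fun x => (g x - g a) * ρ n x) m :=
    (hρ n).bdd_mul (hg.sub continuous_const).measurable.aestronglyMeasurable
      (ae_of_all _ fun x => hC x)
  have heq : ∫ x, g x * ρ n x ∂m - g a = ∫ x, (g x - g a) * ρ n x ∂m := by
    have : ∫ x, g x * ρ n x ∂m = ∫ x, ((g x - g a) * ρ n x + g a * ρ n x) ∂m :=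
      integral_congr_ae (ae_of_all _ fun x => by ring)
    rw [this, integral_add hgi ((hρ n).const_mul _), integral_const_mul, hρ1 n]
    ring
  rw [Real.dist_eq, heq]
  have hind : Integrable (fun x => C * A.indicator (ρ n) x) m :=
    ((hρ n).indicator hAm).const_mul C
  calc |∫ x, (g x - g a) * ρ n x ∂m| ≤ ∫ x, |(g x - g a) * ρ n x| ∂m := abs_integral_le_integral_abs
    _ ≤ ∫ x, (ε / 2 * ρ n x + C * A.indicator (ρ n) x) ∂m := by
        refine integral_mono_ae hgi.abs (((hρ n).const_mul _).add hind) ?_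
        filter_upwards [hρ0 n] with x hx
        simp only [Pi.zero_apply] at hx
        rw [abs_mul, abs_of_nonneg hx]
        by_cases hxA : x ∈ A
        · rw [Set.indicator_of_mem hxA]
          nlinarith [mul_le_mul_of_nonneg_right (hC x) hx]
        · rw [Set.indicator_of_notMem hxA, mul_zero, add_zero]
          have : |g x - g a| < ε / 2 := not_le.1 fun hle => hxA (hKA hle)
          exact mul_le_mul_of_nonneg_right this.le hx
    _ = ε / 2 + C * ∫ x in A, ρ n x ∂m := by
        rw [integral_add ((hρ n).const_mul _) hind, integral_const_mul, integral_const_mul, hρ1 n,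
          integral_indicator hAm, mul_one]
    _ < ε := by linarith [hn₀ n hn]

/-- Let `Xs ⊆ ℝ^N` be compact with a σ-finite Borel measure `m`, let `P` be a Markov
operator preserving the `L¹`-norm, and let `𝒜` be an admissible family of relatively open
subsets with `⋂_{A ∈ 𝒜} Aᶜ = {φ̄}`. If there is a measurable, a.e. positive, locally
integrable (w.r.t. `𝒜`), properly subinvariant function `u`, then for every density `ρ₀`
the measures `μₙ(V) = ∫_V Pⁿρ₀ dm` converge weakly to the Dirac measure at `φ̄`:
`∫ g dμₙ → g(φ̄)` for every continuous `g`. -/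
theorem weak_convergence_to_dirac_of_properlySubinvariant
    {N : ℕ} (Xs : Set (EuclideanSpace ℝ (Fin N))) (hXs : IsCompact Xs)
    (m : Measure Xs) [SigmaFinite m]
    (P : (Xs → ℝ) →ₗ[ℝ] (Xs → ℝ)) (hP : IsMarkovOperator m P)
    (hiso : ∀ f : Xs → ℝ, Integrable f m → ∫ x, |P f x| ∂m = ∫ x, |f x| ∂m)
    (𝒜 : Set (Set Xs)) (h𝒜 : AdmissibleFamily m 𝒜)
    (hopen : ∀ A ∈ 𝒜, IsOpen A)
    (φbar : Xs) (hsingleton : (⋂ A ∈ 𝒜, Aᶜ) = {φbar})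
    (u : Xs → ℝ≥0∞) (hu : Measurable u) (huPos : ∀ᵐ x ∂m, 0 < u x)
    (huLoc : ∀ A ∈ 𝒜, ∫⁻ x in A, u x ∂m < ⊤)
    (hsub : ProperlySubinvariant m P u)
    (ρ₀ : Xs → ℝ) (hρInt : Integrable ρ₀ m) (hρPos : 0 ≤ᵐ[m] ρ₀)
    (hρOne : ∫ x, ρ₀ x ∂m = 1) :
    ∀ g : Xs → ℝ, Continuous g →
      Filter.Tendsto (fun n : ℕ => ∫ x, g x * (P ^ n) ρ₀ x ∂m) atTop (𝓝 (g φbar)) := by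
  intro g hg
  have : CompactSpace Xs := isCompact_iff_compactSpace.1 hXs
  have hnn : ∀ n, 0 ≤ᵐ[m] (P ^ n) ρ₀ := fun n => (hP.pow n).2.1 ρ₀ hρInt hρPos
  refine tendsto_integral_mul_of_concentrating (𝒜 := 𝒜) ?_ h𝒜.2.1 hopen ?_
    (fun n => (hP.pow n).1 ρ₀ hρInt) hnn ?_
    (fun A hA => hP.sweeping h𝒜 hu huPos huLoc hsub hρInt hρPos hA) hg
  · obtain ⟨s, hs, -⟩ := h𝒜.2.2
    exact ⟨s 0, hs 0⟩
  · intro x hx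
    by_contra! hxA
    exact hx (hsingleton.subset (Set.mem_iInter₂.2 hxA))
  · intro n
    have habs : ∀ n, ∫ x, |(P ^ n) ρ₀ x| ∂m = ∫ x, (P ^ n) ρ₀ x ∂m := fun n =>
      integral_congr_ae (by filter_upwards [hnn n] with x hx using abs_of_nonneg hx)
    induction n with
    | zero => exact hρOne
    | succ n ih =>
      rw [← habs, pow_succ', Module.End.mul_apply, hiso _ ((hP.pow n).1 ρ₀ hρInt), habs, ih]
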